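/- arXiv:1801.08664 — 2 statements merged into one kernel-verified Lean document; each statement's English description precedes it below -/
import Mathlib

section
/- Let s′ = I(u′, L^{(N+1)/2} v) be the interleaved sequence of period 2N. Then deg gcd(S_{s′}(x), x^{2N} − 1) ≤ 4 in F_2[x]; consequently the linear complexity of s′ satisfies LC(s′) ≥ 2N − 4. -/
open Finset Polynomial

def Dclass (N f : ℕ) (β : ZMod N) (j : ℕ) : Set (ZMod N) :=
  {x | ∃ k < f, x = β ^ (4 * k + j)}

open Classical in
/-- The binary sequence of period `N` whose characteristic set is `S ⊆ Z_N`. -/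
noncomputable def chiSeq (N : ℕ) (S : Set (ZMod N)) : ℤ → ℕ :=
  fun t => if (t : ZMod N) ∈ S then 1 else 0

/-- The interleaved sequence `I(a,b)`: `I(a,b)(2i) = a(i)`, `I(a,b)(2i+1) = b(i)`. -/
noncomputable def interleave (a b : ℤ → ℕ) : ℤ → ℕ :=
  fun k => if Even k then a (k / 2) else b ((k - 1) / 2)

/-- The left shift `L^m`. -/
def shiftL (m : ℤ) (a : ℤ → ℕ) : ℤ → ℕ := fun i => a (i + m)

/-- The sequence polynomial over F_2 of a sequence of period `n`. -/
noncomputable def Spoly (n : ℕ) (s : ℤ → ℕ) : Polynomial (ZMod 2) :=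
  ∑ i ∈ Finset.range n, Polynomial.C ((s (i : ℤ) : ZMod 2)) * Polynomial.X ^ i

theorem sum_range_natCast_zmod {M : Type*} [AddCommMonoid M] (N : ℕ) [NeZero N]
    (F : ZMod N → M) : ∑ i ∈ range N, F (i : ZMod N) = ∑ a, F a :=
  Finset.sum_bij' (fun i _ => (i : ZMod N)) (fun a _ => a.val) (by simp)
    (fun a _ => by simpa using a.val_lt)
    (fun i hi => by simpa using Nat.mod_eq_of_lt (by simpa using hi)) (by simp) (by simp)

theorem sum_range_two_mul {M : Type*} [AddCommMonoid M] (n : ℕ) (g : ℕ → M) :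
    ∑ i ∈ range (2 * n), g i = ∑ i ∈ range n, (g (2 * i) + g (2 * i + 1)) := by
  induction n with
  | zero => simp
  | succ n ih =>
    rw [Nat.mul_succ, sum_range_succ, sum_range_succ, ih, sum_range_succ, add_assoc]

theorem pow_val_natCast {K : Type*} [Monoid K] {N : ℕ} {α : K} (hα : α ^ N = 1) (n : ℕ) :
    α ^ (n : ZMod N).val = α ^ n := by
  rw [ZMod.val_natCast, ← pow_eq_pow_mod n hα]

theorem pow_val_two_mul {K : Type*} [Monoid K] {N : ℕ} [NeZero N] {α : K} (hα : α ^ N = 1)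
    (a : ZMod N) : α ^ (2 * a).val = (α ^ a.val) ^ 2 := by
  have h := pow_val_natCast hα (2 * a.val)
  rw [← pow_mul, mul_comm a.val, ← h]
  simp

section PrimitiveRoot

variable {N : ℕ} [Fact N.Prime] {β : ZMod N}

theorem exists_pow_eq_of_orderOf (hβ : orderOf β = N - 1) {a : ZMod N} (ha : a ≠ 0) :
    ∃ n < N - 1, β ^ n = a := by
  have hN := (Fact.out : N.Prime).two_le
  have : NeZero (N - 1) := ⟨by omega⟩
  have h : IsPrimitiveRoot β (N - 1) := hβ ▸ IsPrimitiveRoot.orderOf β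
  exact h.eq_pow_of_pow_eq_one (ZMod.pow_card_sub_one_eq_one ha)

theorem primitive_ne_zero (hβ : orderOf β = N - 1) : β ≠ 0 := by
  rintro rfl
  have hN := (Fact.out : N.Prime).two_le
  have h := pow_orderOf_eq_one (0 : ZMod N)
  rw [hβ, zero_pow (by omega)] at h
  exact zero_ne_one h

theorem pow_eq_pow_iff_of_orderOf (hβ : orderOf β = N - 1) (m n : ℕ) :
    β ^ m = β ^ n ↔ m ≡ n [MOD N - 1] := by
  have hN := (Fact.out : N.Prime).two_le
  rw [← hβ]
  exact (orderOf_pos_iff.mp (by omega)).pow_eq_pow_iff_modEq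

theorem isSquare_pow_iff_even (hN : Even (N - 1)) (hβ : orderOf β = N - 1) (n : ℕ) :
    IsSquare (β ^ n) ↔ Even n := by
  refine ⟨fun ⟨b, hb⟩ => ?_, fun h => h.isSquare_pow β⟩
  have hb0 : b ≠ 0 := by
    rintro rfl
    exact pow_ne_zero n (primitive_ne_zero hβ) (by simpa using hb)
  obtain ⟨m, -, rfl⟩ := exists_pow_eq_of_orderOf hβ hb0
  rw [← pow_add, pow_eq_pow_iff_of_orderOf hβ] at hb
  have h2 : n ≡ m + m [MOD 2] := hb.of_dvd hN.two_dvd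
  rw [Nat.even_iff, h2]
  omega

theorem isSquare_mul_iff_not_isSquare (hN : Even (N - 1)) (hβ : orderOf β = N - 1)
    {c a : ZMod N} (hc : ¬ IsSquare c) (ha : a ≠ 0) : IsSquare (c * a) ↔ ¬ IsSquare a := by
  have hc0 : c ≠ 0 := by rintro rfl; exact hc IsSquare.zero
  obtain ⟨k, -, rfl⟩ := exists_pow_eq_of_orderOf hβ hc0
  obtain ⟨n, -, rfl⟩ := exists_pow_eq_of_orderOf hβ ha
  rw [← pow_add]
  rw [isSquare_pow_iff_even hN hβ] at hc ⊢
  rw [isSquare_pow_iff_even hN hβ, Nat.even_add]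
  tauto

theorem pow_mem_Dclass_iff {f : ℕ} (hNf : N = 4 * f + 1) (hβ : orderOf β = N - 1)
    {n j : ℕ} (hn : n < N - 1) (hj : j < 4) : β ^ n ∈ Dclass N f β j ↔ n % 4 = j := by
  constructor
  · rintro ⟨k, hk, h⟩
    rw [pow_eq_pow_iff_of_orderOf hβ] at h
    have := h.of_dvd (show 4 ∣ N - 1 from ⟨f, by omega⟩)
    have : n % 4 = (4 * k + j) % 4 := this
    omega
  · rintro rfl
    exact ⟨n / 4, by omega, by rw [Nat.div_add_mod]⟩

theorem zero_notMem_Dclass {f j : ℕ} (hβ : orderOf β = N - 1) : 0 ∉ Dclass N f β j := by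
  rintro ⟨k, -, h⟩
  exact pow_ne_zero _ (primitive_ne_zero hβ) h.symm

open Classical in
/-- Modulo 2, the two component sequences add up to the indicator of the squares modulo `N`. -/
theorem indicator_add_indicator_eq_isSquare {K : Type*} [Ring K] [CharP K 2] {f : ℕ}
    (hNf : N = 4 * f + 1) (hβ : orderOf β = N - 1) (a : ZMod N) :
    (if a ∈ {0} ∪ Dclass N f β 0 ∪ Dclass N f β 1 then 1 else 0 : K) +
      (if a ∈ Dclass N f β 1 ∪ Dclass N f β 2 then 1 else 0) = if IsSquare a then 1 else 0 := by
  by_cases ha : a = 0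
  · subst ha
    simp [zero_notMem_Dclass hβ]
  obtain ⟨n, hn, rfl⟩ := exists_pow_eq_of_orderOf hβ ha
  have hN : Even (N - 1) := ⟨2 * f, by omega⟩
  simp only [Set.mem_union, Set.mem_singleton_iff, ha, false_or, isSquare_pow_iff_even hN hβ,
    pow_mem_Dclass_iff hNf hβ hn (show 0 < 4 by omega),
    pow_mem_Dclass_iff hNf hβ hn (show 1 < 4 by omega),
    pow_mem_Dclass_iff hNf hβ hn (show 2 < 4 by omega), Nat.even_iff]
  have h4 : n % 4 < 4 := Nat.mod_lt _ (by omega)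
  have h2 : n % 2 = n % 4 % 2 := by omega
  rw [h2]
  interval_cases n % 4 <;> simp [CharTwo.add_self_eq_zero]

open Classical in
/-- The sum over the squares (including `0`) of the `N`-th roots of unity `α ^ (2 * a)` does not
vanish in characteristic 2 when `2` is not a square modulo `N`. -/
theorem sum_isSquare_pow_two_mul_ne_zero {K : Type*} [Field K] [CharP K 2]
    (hβ : orderOf β = N - 1) (hN : N % 8 = 5) {α : K} (hα : α ^ N = 1) :
    ∑ a : ZMod N, (if IsSquare a then α ^ (2 * a).val else 0) ≠ 0 := by
  have hodd : Even (N - 1) := ⟨(N - 1) / 2, by omega⟩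
  have h2 : ¬ IsSquare (2 : ZMod N) := by
    rw [ZMod.exists_sq_eq_two_iff (by omega)]
    omega
  have h20 : (2 : ZMod N) ≠ 0 := fun h => h2 (h ▸ IsSquare.zero)
  by_cases h1 : α = 1
  · subst h1
    simp only [one_pow]
    rw [Fintype.sum_eq_add_sum_compl 0]
    have hneg : IsSquare (-1 : ZMod N) := by
      rw [ZMod.exists_sq_eq_neg_one_iff]
      omega
    have hsq (a : ZMod N) : IsSquare (-a) ↔ IsSquare a := by
      constructor <;> intro h
      · simpa using hneg.mul h
      · simpa using hneg.mul h
    rw [Finset.sum_involution (fun a _ => -a)]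
    · simp
    · intro a _
      simp only [hsq]
      exact CharTwo.add_self_eq_zero _
    · intro a ha _ h
      have : (2 : ZMod N) * a = 0 := by linear_combination -h
      simp_all
    · intro a ha
      simpa using ha
    · simp
  · intro h0
    have hT : ∑ a : ZMod N, (if IsSquare a then α ^ a.val else 0) = 0 := by
      rw [← sq_eq_zero_iff, CharTwo.sum_sq]
      refine Eq.trans ?_ h0
      refine sum_congr rfl fun a _ => ?_
      split_ifs
      · rw [pow_val_two_mul hα]
      · simp
    have hall : ∑ a : ZMod N, α ^ a.val = 0 := by
      rw [← sum_range_natCast_zmod N (fun a => α ^ a.val)]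
      simp only [pow_val_natCast hα]
      have := geom_sum_mul α N
      rw [hα, sub_self] at this
      exact (mul_eq_zero.mp this).resolve_right (sub_ne_zero.mpr h1)
    have hreindex : ∑ a : ZMod N, (if IsSquare a then α ^ (2 * a).val else 0) =
        ∑ a : ZMod N, (if a = 0 ∨ ¬ IsSquare a then α ^ a.val else 0) := by
      refine Fintype.sum_equiv (Equiv.mulLeft₀ 2 h20) _ _ fun a => ?_
      by_cases ha : a = 0
      · simp [ha]
      · simp [ha, h20, isSquare_mul_iff_not_isSquare hodd hβ h2 ha]
    have hsum : ∑ a : ZMod N, (if a = 0 ∨ ¬ IsSquare a then α ^ a.val else 0) +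
        ∑ a : ZMod N, (if IsSquare a then α ^ a.val else 0) =
        ∑ a : ZMod N, α ^ a.val + ∑ a : ZMod N, (if a = 0 then 1 else 0) := by
      rw [← sum_add_distrib, ← sum_add_distrib]
      refine sum_congr rfl fun a _ => ?_
      by_cases ha : a = 0
      · simp [ha]
      · by_cases hs : IsSquare a <;> simp [ha, hs]
    rw [← hreindex, h0, hT, hall] at hsum
    simp at hsum

end PrimitiveRoot

theorem aeval_Spoly {K : Type*} [CommRing K] [Algebra (ZMod 2) K] (n : ℕ) (s : ℤ → ℕ) (α : K) :
    aeval α (Spoly n s) = ∑ i ∈ range n, (s i : K) * α ^ i := by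
  simp [Spoly]

/-- Evaluating the sequence polynomial of `I(a, L^{(N+1)/2} b)` at an `N`-th root of unity. -/
theorem aeval_Spoly_interleave_chiSeq {K : Type*} [CommRing K] [Algebra (ZMod 2) K] {N : ℕ}
    [NeZero N] (hN : Odd N) (A B : Set (ZMod N)) {α : K} (hα : α ^ N = 1) :
    aeval α (Spoly (2 * N)
      (interleave (chiSeq N A) (shiftL (((N + 1) / 2 : ℕ) : ℤ) (chiSeq N B)))) =
    ∑ a : ZMod N, (A.indicator 1 a + B.indicator 1 a) * α ^ (2 * a).val := by
  classical
  obtain ⟨k, hk⟩ := hN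
  have hm : (N + 1) / 2 = k + 1 := by omega
  have hshift : (2 * ((k + 1 : ℕ) : ZMod N)) = 1 := by
    have : ((2 * (k + 1) : ℕ) : ZMod N) = ((N + 1 : ℕ) : ZMod N) := by congr 1; omega
    simpa using this
  rw [aeval_Spoly, sum_range_two_mul, sum_add_distrib]
  simp only [add_mul, sum_add_distrib]
  congr 1
  · rw [← sum_range_natCast_zmod N]
    refine sum_congr rfl fun i _ => ?_
    have := pow_val_natCast hα (2 * i)
    push_cast at this
    rw [this]
    simp [interleave, chiSeq, Set.indicator_apply]
  · rw [← Equiv.sum_comp (Equiv.addRight ((k + 1 : ℕ) : ZMod N)), ← sum_range_natCast_zmod N]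
    refine sum_congr rfl fun i _ => ?_
    have := pow_val_natCast hα (2 * i + 1)
    push_cast at this
    rw [Equiv.coe_addRight, mul_add, hshift, this, hm]
    simp [interleave, shiftL, chiSeq, Set.indicator_apply]

/-- lower bound on the linear complexity of `s' = I(u', L^{(N+1)/2} v)`. -/
theorem stmt16 (N f y : ℕ) (hprime : N.Prime) (hNf : N = 4 * f + 1) (hN5 : 5 ≤ N)
    (hfy : f = y ^ 2) (hy : 0 < y) (hfodd : Odd f)
    (β : ZMod N) (hβ : orderOf β = N - 1)
    (u' v s' : ℤ → ℕ)
    (hu : u' = chiSeq N ({0} ∪ Dclass N f β 0 ∪ Dclass N f β 1))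
    (hv : v = chiSeq N (Dclass N f β 1 ∪ Dclass N f β 2))
    (hs : s' = interleave u' (shiftL (((N + 1) / 2 : ℕ) : ℤ) v)) :
    (EuclideanDomain.gcd (Spoly (2 * N) s') (X ^ (2 * N) - 1)).natDegree ≤ 4 ∧
    2 * N - 4 ≤
      2 * N - (EuclideanDomain.gcd (Spoly (2 * N) s') (X ^ (2 * N) - 1)).natDegree := by
  classical
  have : Fact N.Prime := ⟨hprime⟩
  have hdeg : (EuclideanDomain.gcd (Spoly (2 * N) s') (X ^ (2 * N) - 1)).natDegree = 0 := by
    by_contra hne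
    obtain ⟨α, hα⟩ := IsAlgClosed.exists_aeval_eq_zero (AlgebraicClosure (ZMod 2)) _
      (fun h => hne (natDegree_eq_of_degree_eq_some h))
    have : CharP (AlgebraicClosure (ZMod 2)) 2 := charP_of_injective_algebraMap' (ZMod 2) 2
    have hroot {p : (ZMod 2)[X]}
        (hp : EuclideanDomain.gcd (Spoly (2 * N) s') (X ^ (2 * N) - 1) ∣ p) :
        aeval α p = 0 :=
      zero_dvd_iff.mp (hα ▸ map_dvd (aeval α) hp)
    have hS := hroot (EuclideanDomain.gcd_dvd_left _ _)
    have hX := hroot (EuclideanDomain.gcd_dvd_right _ _)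
    have hαN : α ^ N = 1 := by
      rw [map_sub, map_pow, aeval_X, map_one, mul_comm, pow_mul] at hX
      rw [← sub_eq_zero, ← sq_eq_zero_iff, sub_pow_char, one_pow, hX]
    have hfmod : f % 2 = 1 := Nat.odd_iff.mp hfodd
    rw [hs, hu, hv, aeval_Spoly_interleave_chiSeq ⟨2 * f, by omega⟩ _ _ hαN] at hS
    refine sum_isSquare_pow_two_mul_ne_zero hβ (by omega) hαN (Eq.trans ?_ hS)
    refine sum_congr rfl fun a _ => ?_
    simp only [Set.indicator_apply, Pi.one_apply]
    rw [indicator_add_indicator_eq_isSquare hNf hβ, ite_mul, one_mul, zero_mul]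
  omega
end

section
/- Suppose 2 mod N ∈ D_1. Then for each i ∈ {0,1,2,3} there is at most one j ∈ D_i such that S_{u′}(α^j) + α^{j(N+1)/2} = 0; consequently the polynomial S_{u′}(x) + x^{(N+1)/2} has at most 4 roots in the set {α^j : 1 ≤ j ≤ N−1}. -/
open Finset Polynomial

theorem mul_mem_Dclass {N f : ℕ} {β : ZMod N} (hf : 0 < f) (hβ : β ^ (4 * f) = 1) (m : ℕ)
    {j : ℕ} {x : ZMod N} (hx : x ∈ Dclass N f β j) : β ^ (4 * m) * x ∈ Dclass N f β j := by
  obtain ⟨k, -, rfl⟩ := hx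
  refine ⟨(m + k) % f, Nat.mod_lt _ hf, ?_⟩
  have h : β ^ (4 * (m + k)) = β ^ (4 * ((m + k) % f)) := by
    conv_lhs => rw [← Nat.div_add_mod (m + k) f]
    rw [mul_add, ← mul_assoc, pow_add, pow_mul, hβ, one_pow, one_mul]
  rw [pow_add _ (4 * ((m + k) % f)), ← h]
  ring

theorem exists_pow_mul_of_mem_Dclass {N f : ℕ} {β : ZMod N} (hβ : β ^ (4 * f) = 1) {j : ℕ}
    {x z : ZMod N} (hx : x ∈ Dclass N f β j) (hz : z ∈ Dclass N f β j) :
    ∃ m, z = β ^ (4 * m) * x := by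
  obtain ⟨k, hk, rfl⟩ := hx
  obtain ⟨l, -, rfl⟩ := hz
  refine ⟨l + (f - k), ?_⟩
  have h : 4 * (l + (f - k)) + (4 * k + j) = 4 * f + (4 * l + j) := by omega
  rw [← pow_add, h, pow_add _ (4 * f), hβ, one_mul]

theorem exists_mem_Dclass {N f : ℕ} [Fact N.Prime] (hNf : N = 4 * f + 1) (hf : 0 < f)
    {β : ZMod N} (hβ : orderOf β = N - 1) {x : ZMod N} (hx : x ≠ 0) :
    ∃ i < 4, x ∈ Dclass N f β i := by
  have : NeZero (N - 1) := ⟨by omega⟩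
  obtain ⟨m, hm, rfl⟩ := (hβ ▸ IsPrimitiveRoot.orderOf β).eq_pow_of_pow_eq_one
    (ZMod.pow_card_sub_one_eq_one hx)
  exact ⟨m % 4, Nat.mod_lt _ (by norm_num), m / 4, by omega, by rw [Nat.div_add_mod]⟩

open Classical in
theorem aeval_Spoly_chiSeq {N : ℕ} [NeZero N] (S : Set (ZMod N)) {F : Type*} [Field F]
    [Algebra (ZMod 2) F] {α : F} (hα : α ^ N = 1) (j : ZMod N) :
    aeval (α ^ j.val) (Spoly N (chiSeq N S)) =
      ∑ x : ZMod N, if x ∈ S then α ^ (j * x).val else 0 := by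
  rw [Spoly, map_sum]
  refine Finset.sum_bij' (fun i _ => (i : ZMod N)) (fun x _ => x.val) (by simp)
    (fun x _ => Finset.mem_range.2 x.val_lt)
    (fun i hi => ZMod.val_cast_of_lt (Finset.mem_range.1 hi)) (by simp) fun i hi => ?_
  have hval : α ^ (j * (i : ZMod N)).val = (α ^ j.val) ^ i := by
    rw [ZMod.val_mul, ZMod.val_cast_of_lt (Finset.mem_range.1 hi), ← pow_mul]
    exact (pow_eq_pow_mod _ hα).symm
  rw [hval]
  by_cases h : (i : ZMod N) ∈ S <;> simp [chiSeq, h]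

theorem aeval_Spoly_chiSeq_mul {N : ℕ} [Fact N.Prime] {S : Set (ZMod N)} {F : Type*} [Field F]
    [Algebra (ZMod 2) F] {α : F} (hα : α ^ N = 1) {c : ZMod N} (hc : c ≠ 0)
    (hS : ∀ x, c * x ∈ S ↔ x ∈ S) (j : ZMod N) :
    aeval (α ^ (c * j).val) (Spoly N (chiSeq N S)) =
      aeval (α ^ j.val) (Spoly N (chiSeq N S)) := by
  classical
  rw [aeval_Spoly_chiSeq S hα, aeval_Spoly_chiSeq S hα,
    ← Equiv.sum_comp (Equiv.mulLeft₀ c hc) fun x => if x ∈ S then α ^ (j * x).val else 0]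
  refine Finset.sum_congr rfl fun x _ => ?_
  simp only [Equiv.mulLeft₀_apply, hS, mul_left_comm j c x, mul_assoc]

/-- if `2 ∈ D_1`, at most one `j ∈ D_i` satisfies
`S_{u'}(α^j) + α^{j(N+1)/2} = 0`, hence `S_{u'}(x) + x^{(N+1)/2}` has at most 4 roots
among `{α^j : 1 ≤ j ≤ N-1}`. -/
theorem stmt18 (N f y : ℕ) (hprime : N.Prime) (hNf : N = 4 * f + 1) (hN5 : 5 ≤ N)
    (hfy : f = y ^ 2) (hy : 0 < y) (hfodd : Odd f)
    (β : ZMod N) (hβ : orderOf β = N - 1)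
    (F : Type*) [Field F] [Algebra (ZMod 2) F]
    (α : F) (hα : IsPrimitiveRoot α N)
    (h2 : (2 : ZMod N) ∈ Dclass N f β 1)
    (u' : ℤ → ℕ)
    (hu' : u' = chiSeq N ({0} ∪ Dclass N f β 0 ∪ Dclass N f β 1)) :
    (∀ i ∈ ({0, 1, 2, 3} : Set ℕ), ∀ j₁ ∈ Dclass N f β i, ∀ j₂ ∈ Dclass N f β i,
      Polynomial.aeval (α ^ j₁.val) (Spoly N u') + α ^ (j₁.val * ((N + 1) / 2)) = 0 →
      Polynomial.aeval (α ^ j₂.val) (Spoly N u') + α ^ (j₂.val * ((N + 1) / 2)) = 0 →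
      j₁ = j₂) ∧
    ({ζ : F | (∃ j : ℕ, 1 ≤ j ∧ j ≤ N - 1 ∧ ζ = α ^ j) ∧
        Polynomial.aeval ζ (Spoly N u' + X ^ ((N + 1) / 2)) = 0}).ncard ≤ 4 := by
  have : Fact N.Prime := ⟨hprime⟩
  have hf : 0 < f := by omega
  have hβ1 : β ^ (4 * f) = 1 := by
    rw [show 4 * f = orderOf β by omega, pow_orderOf_eq_one]
  have hβ0 : β ≠ 0 := by
    rintro rfl
    rw [zero_pow (by omega)] at hβ1
    exact zero_ne_one hβ1
  have hαN : α ^ N = 1 := hα.pow_eq_one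
  have hmem : ∀ m x, x ∈ {0} ∪ Dclass N f β 0 ∪ Dclass N f β 1 →
      β ^ (4 * m) * x ∈ {0} ∪ Dclass N f β 0 ∪ Dclass N f β 1 := by
    rintro m x ((rfl | h) | h)
    · simp
    · exact .inl (.inr (mul_mem_Dclass hf hβ1 m h))
    · exact .inr (mul_mem_Dclass hf hβ1 m h)
  have hS : ∀ m x, β ^ (4 * m) * x ∈ {0} ∪ Dclass N f β 0 ∪ Dclass N f β 1 ↔
      x ∈ {0} ∪ Dclass N f β 0 ∪ Dclass N f β 1 := by
    refine fun m x => ⟨fun h => ?_, hmem m x⟩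
    have hinv : β ^ (4 * (m * (f - 1))) * (β ^ (4 * m) * x) = x := by
      obtain ⟨g, rfl⟩ : ∃ g, f = g + 1 := ⟨f - 1, by omega⟩
      rw [← mul_assoc, ← pow_add, Nat.add_sub_cancel,
        show 4 * (m * g) + 4 * m = 4 * (g + 1) * m by ring, pow_mul, hβ1, one_pow, one_mul]
    exact hinv ▸ hmem (m * (f - 1)) _ h
  have huniq : ∀ i, ∀ j₁ ∈ Dclass N f β i, ∀ j₂ ∈ Dclass N f β i,
      Polynomial.aeval (α ^ j₁.val) (Spoly N u') + α ^ (j₁.val * ((N + 1) / 2)) = 0 →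
      Polynomial.aeval (α ^ j₂.val) (Spoly N u') + α ^ (j₂.val * ((N + 1) / 2)) = 0 →
      j₁ = j₂ := by
    intro i j₁ h₁ j₂ h₂ e₁ e₂
    obtain ⟨m, rfl⟩ := exists_pow_mul_of_mem_Dclass hβ1 h₁ h₂
    rw [hu', aeval_Spoly_chiSeq_mul hαN (pow_ne_zero _ hβ0) (hS m), ← hu', ← e₁] at e₂
    have hsq : ∀ j : ZMod N, (α ^ (j.val * ((N + 1) / 2))) ^ 2 = α ^ j.val := by
      intro j
      have hN : (N + 1) / 2 * 2 = N + 1 := by omega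
      rw [← pow_mul, mul_assoc, hN, mul_add, mul_one, pow_add, mul_comm, mul_comm j.val, pow_mul,
        hαN, one_pow, mul_one]
    have hpow := congrArg (· ^ 2) (add_left_cancel e₂)
    simp only [hsq] at hpow
    exact (ZMod.val_injective N (hα.pow_inj (ZMod.val_lt _) (ZMod.val_lt _) hpow)).symm
  refine ⟨fun i _ => huniq i, ?_⟩
  set A := {ζ : F | (∃ j : ℕ, 1 ≤ j ∧ j ≤ N - 1 ∧ ζ = α ^ j) ∧
    Polynomial.aeval ζ (Spoly N u' + X ^ ((N + 1) / 2)) = 0}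
  have hcls : ∀ ζ ∈ A, ∃ i < 4, ∃ j ∈ Dclass N f β i, ζ = α ^ j.val ∧
      Polynomial.aeval (α ^ j.val) (Spoly N u') + α ^ (j.val * ((N + 1) / 2)) = 0 := by
    rintro _ ⟨⟨j, hj1, hjN, rfl⟩, h0⟩
    have hval : (j : ZMod N).val = j := ZMod.val_cast_of_lt (by omega)
    have hj0 : (j : ZMod N) ≠ 0 := by
      rw [← ZMod.val_ne_zero, hval]
      omega
    obtain ⟨i, hi, hji⟩ := exists_mem_Dclass hNf hf hβ hj0
    refine ⟨i, hi, j, hji, by rw [hval], ?_⟩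
    rw [hval, pow_mul]
    simpa using h0
  choose! g hg J hJ hζ h0 using hcls
  have hcard := Set.ncard_le_ncard_of_injOn (t := Set.Iio 4) g hg
    (fun ζ₁ h₁ ζ₂ h₂ h => by
      rw [hζ ζ₁ h₁, hζ ζ₂ h₂,
        huniq _ _ (hJ ζ₁ h₁) _ (h ▸ hJ ζ₂ h₂) (h0 ζ₁ h₁) (h0 ζ₂ h₂)])
    (Set.finite_Iio 4)
  simpa using hcard
end
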